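/- arXiv:1005.1631 — 2 statements merged into one kernel-verified Lean document; each statement's English description precedes it below -/
import Mathlib

section
/- Define the stellohedron h-polynomials S_n(α,t) = α^n + Σ_{i=1}^{n} (Σ_{k=i}^{n} binom(n,k)·A(k,i−1))·α^{n-i}·t^i, with S_0 = 1, and the permutohedron h-polynomials P_m(α,t) = Σ_{k=0}^{m} A(m+1,k)·α^k·t^{m-k}. Then for every n ≥ 1: S_n(α,t) = (α+t)·S_{n-1}(α,t) + αt·Σ_{i=1}^{n-1} binom(n−1,i−1)·S_{i-1}(α,t)·P_{n-i-1}(α,t). -/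
open Finset MvPolynomial
open scoped Classical

/-- The number of descents of a permutation `σ` of `Fin m`. -/
noncomputable def numDescents (m : ℕ) (σ : Equiv.Perm (Fin m)) : ℕ :=
  ((Finset.range m).filter fun i =>
    ∃ h : i + 1 < m, σ ⟨i + 1, h⟩ < σ ⟨i, Nat.lt_of_succ_lt h⟩).card

/-- The Eulerian number `A(m,k)`: the number of permutations of `{1,…,m}` with exactly
`k` descents (so `A(0,0) = 1`). -/
noncomputable def eulerian (m k : ℕ) : ℕ :=
  ((Finset.univ : Finset (Equiv.Perm (Fin m))).filter fun σ => numDescents m σ = k).card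

/-- The h-polynomial of the permutohedron `Pe^m`:
`P_m(α,t) = Σ_{k=0}^{m} A(m+1,k)·α^k·t^{m-k}`. -/
noncomputable def permutoH (m : ℕ) : MvPolynomial (Fin 2) ℚ :=
  ∑ k ∈ Finset.range (m + 1),
    MvPolynomial.C ((eulerian (m + 1) k : ℚ)) *
      MvPolynomial.X 0 ^ k * MvPolynomial.X 1 ^ (m - k)

/-- The h-polynomial of the stellohedron `St^n`:
`S_n(α,t) = α^n + Σ_{i=1}^{n} (Σ_{k=i}^{n} binom(n,k)·A(k,i−1))·α^{n-i}·t^i`. -/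
noncomputable def stelloH (n : ℕ) : MvPolynomial (Fin 2) ℚ :=
  MvPolynomial.X 0 ^ n +
    ∑ i ∈ Finset.Icc 1 n,
      MvPolynomial.C (((∑ k ∈ Finset.Icc i n, n.choose k * eulerian k (i - 1)) : ℕ) : ℚ) *
        MvPolynomial.X 0 ^ (n - i) * MvPolynomial.X 1 ^ i

/-- `σ` has a descent at the (zero-based) position `i`. -/
def HasDescentAt {m : ℕ} (σ : Equiv.Perm (Fin m)) (i : ℕ) : Prop :=
  ∃ h : i + 1 < m, σ ⟨i + 1, h⟩ < σ ⟨i, Nat.lt_of_succ_lt h⟩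

theorem HasDescentAt.lt {m : ℕ} {σ : Equiv.Perm (Fin m)} {i : ℕ} (h : HasDescentAt σ i) :
    i + 1 < m :=
  h.1

theorem numDescents_eq_card {m : ℕ} (σ : Equiv.Perm (Fin m)) :
    numDescents m σ = ((range m).filter fun i => HasDescentAt σ i).card := by
  unfold numDescents HasDescentAt
  congr

/-- Insert a new maximal value into the permutation `σ` at position `p`. -/
def insertMax {m : ℕ} (σ : Equiv.Perm (Fin m)) (p : Fin (m + 1)) : Equiv.Perm (Fin (m + 1)) :=
  (finSuccEquiv' p).trans ((Equiv.optionCongr σ).trans (finSuccEquiv' (Fin.last m)).symm)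

section insertMax

variable {m : ℕ} (σ : Equiv.Perm (Fin m)) (p : Fin (m + 1))

theorem insertMax_self : insertMax σ p p = Fin.last m := by
  simp [insertMax]

theorem insertMax_succAbove (j : Fin m) :
    insertMax σ p (p.succAbove j) = (σ j).castSucc := by
  simp [insertMax]

theorem insertMax_of_lt {i : ℕ} (h : i < p) :
    insertMax σ p ⟨i, by omega⟩ = (σ ⟨i, by omega⟩).castSucc := by
  rw [← insertMax_succAbove, Fin.succAbove_of_castSucc_lt _ _ (by simpa [Fin.lt_def] using h)]
  rfl

theorem insertMax_of_gt {i : ℕ} (h : p ≤ i) (hi : i < m) :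
    insertMax σ p ⟨i + 1, by omega⟩ = (σ ⟨i, hi⟩).castSucc := by
  rw [← insertMax_succAbove, Fin.succAbove_of_le_castSucc _ _ (by simpa [Fin.le_def] using h)]
  rfl

theorem insertMax_of_eq {i : ℕ} (h : i = p) :
    insertMax σ p ⟨i, by omega⟩ = Fin.last m := by
  subst h
  exact insertMax_self σ p

theorem insertMax_bijective :
    Function.Bijective fun x : Equiv.Perm (Fin m) × Fin (m + 1) => insertMax x.1 x.2 := by
  rw [Fintype.bijective_iff_injective_and_card]
  constructor
  · rintro ⟨σ, p⟩ ⟨τ, q⟩ h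
    dsimp only at h
    have hpq : p = q := by
      apply (insertMax τ q).injective
      rw [insertMax_self, ← h, insertMax_self]
    subst hpq
    congr 1
    ext j : 1
    apply Fin.castSucc_injective
    rw [← insertMax_succAbove σ p, h, insertMax_succAbove]
  · simp [Fintype.card_perm, Nat.factorial_succ, mul_comm]

theorem hasDescentAt_insertMax_of_lt {i : ℕ} (h : i + 1 < p) :
    HasDescentAt (insertMax σ p) i ↔ HasDescentAt σ i := by
  have h1 := insertMax_of_lt σ p h
  have h2 := insertMax_of_lt σ p (Nat.lt_of_succ_lt h)
  constructor
  · rintro ⟨_, hd⟩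
    rw [h1, h2] at hd
    exact ⟨by omega, by simpa using hd⟩
  · rintro ⟨_, hd⟩
    refine ⟨by omega, ?_⟩
    rw [h1, h2]
    simpa using hd

theorem not_hasDescentAt_insertMax {i : ℕ} (h : i + 1 = p) :
    ¬ HasDescentAt (insertMax σ p) i := by
  rintro ⟨_, hd⟩
  rw [insertMax_of_eq σ p h] at hd
  exact absurd (Fin.le_last _) (not_le.mpr hd)

theorem hasDescentAt_insertMax_self : HasDescentAt (insertMax σ p) p ↔ (p : ℕ) < m := by
  constructor
  · intro h
    have := h.lt
    omega
  · intro h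
    refine ⟨by omega, ?_⟩
    rw [insertMax_of_gt σ p le_rfl h, insertMax_of_eq σ p rfl]
    exact Fin.castSucc_lt_last _

theorem hasDescentAt_insertMax_of_ge {i : ℕ} (h : p ≤ i) :
    HasDescentAt (insertMax σ p) (i + 1) ↔ HasDescentAt σ i := by
  constructor
  · rintro ⟨hm, hd⟩
    rw [insertMax_of_gt σ p (Nat.le_succ_of_le h) (by omega),
      insertMax_of_gt σ p h (by omega)] at hd
    exact ⟨by omega, by simpa using hd⟩
  · rintro ⟨hm, hd⟩
    refine ⟨by omega, ?_⟩
    rw [insertMax_of_gt σ p (Nat.le_succ_of_le h) (by omega),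
      insertMax_of_gt σ p h (by omega)]
    simpa using hd

theorem numDescents_insertMax_zero (hm : 0 < m) :
    numDescents (m + 1) (insertMax σ 0) = numDescents m σ + 1 := by
  rw [numDescents_eq_card, numDescents_eq_card, card_filter, card_filter, sum_range_succ']
  congr 1
  · exact sum_congr rfl fun i _ => by
      rw [hasDescentAt_insertMax_of_ge σ 0 (Nat.zero_le i)]
  · rw [if_pos]
    exact (hasDescentAt_insertMax_self σ 0).mpr hm

theorem numDescents_insertMax_succ {a : ℕ} (ha : a < m) :
    numDescents (m + 1) (insertMax σ ⟨a + 1, Nat.succ_lt_succ ha⟩) +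
        (if HasDescentAt σ a then 1 else 0) =
      numDescents m σ + if a + 1 < m then 1 else 0 := by
  obtain ⟨b, rfl⟩ := Nat.exists_eq_add_of_lt ha
  set p : Fin (a + b + 1 + 1) := ⟨a + 1, Nat.succ_lt_succ ha⟩ with hp
  have hpa : (p : ℕ) = a + 1 := rfl
  have hself := hasDescentAt_insertMax_self σ p
  rw [hpa] at hself
  have h0 := not_hasDescentAt_insertMax σ p hpa.symm
  have split₁ (f : ℕ → ℕ) : ∑ i ∈ range (a + b + 1), f i =
      ∑ i ∈ range a, f i + f a + ∑ i ∈ range b, f (a + 1 + i) := by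
    rw [← sum_range_succ, ← sum_range_add, add_right_comm]
  have split₂ (f : ℕ → ℕ) : ∑ i ∈ range (a + b + 1 + 1), f i =
      ∑ i ∈ range a, f i + f a + f (a + 1) + ∑ i ∈ range b, f (a + 1 + 1 + i) := by
    rw [← sum_range_succ, ← sum_range_succ, ← sum_range_add]
    congr 2
    ring
  rw [numDescents_eq_card, numDescents_eq_card, card_filter, card_filter, split₁, split₂,
    if_neg h0]
  have e1 : ∑ i ∈ range a, (if HasDescentAt (insertMax σ p) i then 1 else 0) =
      ∑ i ∈ range a, if HasDescentAt σ i then 1 else 0 :=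
    sum_congr rfl fun i hi => by
      rw [hasDescentAt_insertMax_of_lt σ p (by rw [hpa]; simpa using hi)]
  have e2 : ∑ i ∈ range b, (if HasDescentAt (insertMax σ p) (a + 1 + 1 + i) then 1 else 0) =
      ∑ i ∈ range b, if HasDescentAt σ (a + 1 + i) then 1 else 0 :=
    sum_congr rfl fun i hi => by
      rw [show a + 1 + 1 + i = a + 1 + i + 1 by ring,
        hasDescentAt_insertMax_of_ge σ p (by omega)]
  have e3 : (if HasDescentAt (insertMax σ p) (a + 1) then 1 else 0) =
      if a + 1 < a + b + 1 then 1 else 0 := by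
    simp only [hself]
  rw [e1, e2, e3]
  omega

theorem sum_numDescents_insertMax (F : ℕ → ℕ) :
    ∑ q, F (numDescents (m + 1) (insertMax σ q)) =
      (numDescents m σ + 1) * F (numDescents m σ) +
        (m - numDescents m σ) * F (numDescents m σ + 1) := by
  obtain _ | m := m
  · have h1 : numDescents 1 (insertMax σ 0) = 0 := by
      rw [numDescents_eq_card, card_eq_zero, filter_eq_empty_iff]
      intro i _ h
      have := h.lt
      omega
    have h0 : numDescents 0 σ = 0 := rfl
    simp [h0, h1]
  have hlast : ¬ HasDescentAt σ m := fun h => absurd h.lt (lt_irrefl _)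
  have hd : numDescents (m + 1) σ = ((range m).filter fun i => HasDescentAt σ i).card := by
    rw [numDescents_eq_card, range_add_one, filter_insert, if_neg hlast]
  have hsum : ∑ a : Fin (m + 1), F (numDescents (m + 1 + 1) (insertMax σ a.succ)) =
      ∑ a ∈ range (m + 1), if HasDescentAt σ a ∨ a = m then F (numDescents (m + 1) σ)
        else F (numDescents (m + 1) σ + 1) := by
    rw [sum_range]
    refine sum_congr rfl fun a _ => ?_
    have h := numDescents_insertMax_succ σ a.2
    have ha := a.2
    change numDescents (m + 1 + 1) (insertMax σ a.succ) + _ = _ at h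
    by_cases hda : HasDescentAt σ a
    · have := hda.lt
      rw [if_pos hda, if_pos hda.lt] at h
      rw [if_pos (Or.inl hda), Nat.add_right_cancel h]
    · rw [if_neg hda, add_zero] at h
      by_cases ham : (a : ℕ) = m
      · rw [if_pos (Or.inr ham), h, if_neg (by omega), add_zero]
      · rw [if_neg (by tauto), h, if_pos (by omega)]
  have hrest : ∑ a ∈ range m, (if HasDescentAt σ a ∨ a = m then F (numDescents (m + 1) σ)
      else F (numDescents (m + 1) σ + 1)) =
      numDescents (m + 1) σ * F (numDescents (m + 1) σ) +
        (m - numDescents (m + 1) σ) * F (numDescents (m + 1) σ + 1) := by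
    have : ∀ a ∈ range m, (if HasDescentAt σ a ∨ a = m then F (numDescents (m + 1) σ)
        else F (numDescents (m + 1) σ + 1)) = if HasDescentAt σ a then F (numDescents (m + 1) σ)
        else F (numDescents (m + 1) σ + 1) := by
      intro a ha
      have : a ≠ m := (mem_range.mp ha).ne
      simp only [this, or_false]
    have hc := card_filter_add_card_filter_not (s := range m) (fun i => HasDescentAt σ i)
    rw [card_range] at hc
    rw [sum_congr rfl this, sum_ite, sum_const, sum_const, smul_eq_mul, smul_eq_mul, hd]
    congr 2
    omega
  have hle : numDescents (m + 1) σ ≤ m := by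
    rw [hd]
    exact (card_filter_le _ _).trans_eq (card_range m)
  rw [Fin.sum_univ_succ, hsum, sum_range_succ, hrest, if_pos (Or.inr rfl),
    numDescents_insertMax_zero σ (Nat.succ_pos m), Nat.succ_sub hle,
    Nat.succ_eq_add_one]
  ring

end insertMax

theorem eulerian_eq_sum (m k : ℕ) :
    eulerian m k = ∑ σ : Equiv.Perm (Fin m), if numDescents m σ = k then 1 else 0 :=
  card_filter _ _

theorem eulerian_succ (m k : ℕ) :
    eulerian (m + 1) k = ∑ σ : Equiv.Perm (Fin m),
      ((numDescents m σ + 1) * (if numDescents m σ = k then 1 else 0) +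
        (m - numDescents m σ) * if numDescents m σ + 1 = k then 1 else 0) := by
  rw [eulerian_eq_sum, ← insertMax_bijective.sum_comp, Fintype.sum_prod_type]
  exact sum_congr rfl fun σ _ =>
    sum_numDescents_insertMax σ fun d => if d = k then 1 else 0

theorem eulerian_succ_zero (m : ℕ) : eulerian (m + 1) 0 = eulerian m 0 := by
  rw [eulerian_succ, eulerian_eq_sum]
  refine sum_congr rfl fun σ _ => ?_
  by_cases h : numDescents m σ = 0 <;> simp [h]

theorem eulerian_succ_succ (m k : ℕ) :
    eulerian (m + 1) (k + 1) = (k + 2) * eulerian m (k + 1) + (m - k) * eulerian m k := by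
  rw [eulerian_succ, eulerian_eq_sum, eulerian_eq_sum, mul_sum, mul_sum, ← sum_add_distrib]
  refine sum_congr rfl fun σ _ => ?_
  congr 1
  · split_ifs with h
    · rw [h]
    · simp
  · simp only [Nat.add_right_cancel_iff]
    split_ifs with h
    · rw [h]
    · simp

theorem eulerian_zero_succ (k : ℕ) : eulerian 0 (k + 1) = 0 := by
  rw [eulerian_eq_sum]
  exact sum_eq_zero fun σ _ => if_neg (Nat.succ_ne_zero k).symm

theorem eulerian_zero_zero : eulerian 0 0 = 1 := by
  rw [eulerian_eq_sum]
  have : ∀ σ : Equiv.Perm (Fin 0), numDescents 0 σ = 0 := fun _ => rfl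
  simp [this]

theorem eulerian_succ_of_lt {m k : ℕ} (h : m < k) : eulerian (m + 1) k = 0 := by
  induction m generalizing k with
  | zero =>
    obtain _ | k := k
    · omega
    · rw [eulerian_succ_succ, eulerian_zero_succ, Nat.zero_sub, mul_zero, zero_mul, add_zero]
  | succ m ih =>
    obtain _ | k := k
    · omega
    · rw [eulerian_succ_succ, ih (by omega), ih (by omega), mul_zero, mul_zero, add_zero]

theorem eulerian_self (m : ℕ) : eulerian (m + 1) (m + 1) = 0 :=
  eulerian_succ_of_lt (Nat.lt_succ_self m)

theorem eulerian_symm (i j : ℕ) : eulerian (i + j + 1) i = eulerian (i + j + 1) j := by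
  generalize hm : i + j = m
  induction m generalizing i j with
  | zero => rw [show i = j by omega]
  | succ m ih =>
    obtain _ | i := i
    · obtain rfl : j = m + 1 := by omega
      rw [eulerian_succ_zero, eulerian_succ_succ, eulerian_self, ih 0 m (by omega)]
      simp
    · obtain _ | j := j
      · obtain rfl : i = m := by omega
        rw [eulerian_succ_zero, eulerian_succ_succ, eulerian_self, ih 0 i (by omega)]
        simp
      · rw [eulerian_succ_succ, eulerian_succ_succ (m + 1) j, ih (i + 1) j (by omega),
          ih i (j + 1) (by omega), show m + 1 - i = j + 2 by omega,
          show m + 1 - j = i + 2 by omega]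
        ring


/-- The exponential generating function of a sequence. -/
noncomputable def egf {R : Type*} [CommRing R] [Algebra ℚ R] (a : ℕ → R) : PowerSeries R :=
  PowerSeries.mk fun n => ((n.factorial : ℚ)⁻¹) • a n

section egf

variable {R : Type*} [CommRing R] [Algebra ℚ R]

theorem coeff_egf (a : ℕ → R) (n : ℕ) :
    PowerSeries.coeff n (egf a) = ((n.factorial : ℚ)⁻¹) • a n :=
  PowerSeries.coeff_mk _ _

theorem egf_injective : Function.Injective (egf : (ℕ → R) → PowerSeries R) := by
  intro a b h
  funext n
  have hn := congrArg (PowerSeries.coeff n) h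
  rw [coeff_egf, coeff_egf] at hn
  have hf : (n.factorial : ℚ) ≠ 0 := by positivity
  have := congrArg (fun x => (n.factorial : ℚ) • x) hn
  simpa only [smul_inv_smul₀ hf] using this

theorem egf_add (a b : ℕ → R) : egf a + egf b = egf fun n => a n + b n := by
  ext n
  simp only [map_add, coeff_egf, smul_add]

theorem C_mul_egf (r : R) (a : ℕ → R) :
    PowerSeries.C r * egf a = egf fun n => r * a n := by
  ext n
  simp only [PowerSeries.coeff_C_mul, coeff_egf, mul_smul_comm]

theorem egf_mul (a b : ℕ → R) :
    egf a * egf b =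
      egf fun n => ∑ p ∈ antidiagonal n, (n.choose p.1 : R) * (a p.1 * b p.2) := by
  ext n
  simp only [PowerSeries.coeff_mul, coeff_egf, smul_sum]
  refine sum_congr rfl fun p hp => ?_
  obtain ⟨i, j⟩ := p
  rw [HasAntidiagonal.mem_antidiagonal] at hp
  subst hp
  dsimp only
  rw [smul_mul_smul_comm, ← nsmul_eq_mul, ← Nat.cast_smul_eq_nsmul ℚ, smul_smul]
  congr 1
  rw [Nat.cast_add_choose]
  have h1 : (i.factorial : ℚ) ≠ 0 := by positivity
  have h2 : (j.factorial : ℚ) ≠ 0 := by positivity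
  have h3 : ((i + j).factorial : ℚ) ≠ 0 := by positivity
  field_simp

theorem derivative_egf (a : ℕ → R) :
    PowerSeries.derivative R (egf a) = egf fun n => a (n + 1) := by
  ext n
  rw [PowerSeries.coeff_derivative, coeff_egf, coeff_egf, mul_comm, ← Nat.cast_succ,
    ← nsmul_eq_mul, ← Nat.cast_smul_eq_nsmul ℚ, smul_smul]
  congr 1
  rw [Nat.factorial_succ]
  have h1 : (n.factorial : ℚ) ≠ 0 := by positivity
  push_cast
  field_simp

end egf

/-- The coefficientwise extension of a derivation to power series. -/
noncomputable def coeffwise {R : Type*} [CommRing R] [Algebra ℚ R] (D : Derivation ℚ R R)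
    (F : PowerSeries R) : PowerSeries R :=
  PowerSeries.mk fun n => D (PowerSeries.coeff n F)

section coeffwise

variable {R : Type*} [CommRing R] [Algebra ℚ R] (D : Derivation ℚ R R)

theorem coeffwise_add (F G : PowerSeries R) :
    coeffwise D (F + G) = coeffwise D F + coeffwise D G := by
  ext n
  simp [coeffwise]

theorem coeffwise_sub (F G : PowerSeries R) :
    coeffwise D (F - G) = coeffwise D F - coeffwise D G := by
  ext n
  simp [coeffwise]

theorem coeffwise_mul (F G : PowerSeries R) :
    coeffwise D (F * G) = F * coeffwise D G + G * coeffwise D F := by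
  ext n
  rw [mul_comm G]
  simp only [coeffwise, PowerSeries.coeff_mk, PowerSeries.coeff_mul, map_add, map_sum,
    Derivation.leibniz, smul_eq_mul, sum_add_distrib]
  congr 1
  exact sum_congr rfl fun p _ => mul_comm _ _

theorem coeffwise_one : coeffwise D 1 = 0 := by
  ext n
  by_cases h : n = 0 <;> simp [coeffwise, PowerSeries.coeff_one, h]

theorem coeffwise_C (r : R) : coeffwise D (PowerSeries.C r) = PowerSeries.C (D r) := by
  ext n
  by_cases h : n = 0 <;> simp [coeffwise, PowerSeries.coeff_C, h]

theorem coeffwise_egf (a : ℕ → R) : coeffwise D (egf a) = egf fun n => D (a n) := by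
  ext n
  simp [coeffwise, coeff_egf]

theorem derivative_coeffwise (F : PowerSeries R) :
    PowerSeries.derivative R (coeffwise D F) = coeffwise D (PowerSeries.derivative R F) := by
  ext n
  simp [coeffwise, PowerSeries.coeff_derivative, mul_comm]

/-- A solution `W` of `W' = D W + c W` without constant term vanishes. -/
theorem eq_zero_of_derivative_eq [IsDomain R] (c : R) (W : PowerSeries R)
    (h0 : PowerSeries.coeff 0 W = 0)
    (hW : PowerSeries.derivative R W = coeffwise D W + PowerSeries.C c * W) : W = 0 := by
  ext n
  rw [map_zero]
  induction n with
  | zero => exact h0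
  | succ n ih =>
    have h := congrArg (PowerSeries.coeff n) hW
    rw [PowerSeries.coeff_derivative, map_add, PowerSeries.coeff_C_mul, ih] at h
    simp only [coeffwise, PowerSeries.coeff_mk, ih, map_zero, mul_zero, add_zero] at h
    have : CharZero R := algebraRat.charZero R
    exact (mul_eq_zero.mp h).resolve_right (Nat.cast_add_one_ne_zero n)

/-- If `D a = D t = a t` and `B' = 1 + (a + t) B + D B`, then `B` solves a Riccati equation. -/
theorem riccati_of_derivative_eq [IsDomain R] {a t : R} (ha : D a = a * t) (ht : D t = a * t)
    {B : PowerSeries R} (h0 : PowerSeries.coeff 0 B = 0)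
    (hB : PowerSeries.derivative R B = 1 + PowerSeries.C (a + t) * B + coeffwise D B) :
    PowerSeries.derivative R B =
      1 + PowerSeries.C (a + t) * B + PowerSeries.C (a * t) * (B * B) := by
  suffices h : coeffwise D B - PowerSeries.C (a * t) * (B * B) = 0 by
    rw [hB, sub_eq_zero.mp h]
  refine eq_zero_of_derivative_eq D (a + t) _ ?_ ?_
  · rw [PowerSeries.coeff_zero_eq_constantCoeff_apply] at h0
    simp [coeffwise, h0]
  · have hat : D (a * t) = a * t * (a + t) := by
      rw [Derivation.leibniz, ha, ht, smul_eq_mul, smul_eq_mul]; ring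
    have hc : PowerSeries.derivative R (PowerSeries.C (a * t)) = 0 :=
      PowerSeries.derivative_C
    rw [map_sub, derivative_coeffwise, Derivation.leibniz, Derivation.leibniz, hc, hB]
    simp only [coeffwise_sub, coeffwise_add, coeffwise_mul, coeffwise_one, coeffwise_C, hat,
      map_add D, ha, ht, smul_eq_mul]
    simp only [map_add, map_mul]
    ring

end coeffwise

/-- The derivation of `ℚ[α, t]` with `α ↦ α t` and `t ↦ α t`. -/
noncomputable def mixedDerivation :
    Derivation ℚ (MvPolynomial (Fin 2) ℚ) (MvPolynomial (Fin 2) ℚ) :=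
  (X 0 * X 1 : MvPolynomial (Fin 2) ℚ) • (pderiv 0 + pderiv 1)

theorem mixedDerivation_X_zero : mixedDerivation (X 0) = X 0 * X 1 := by
  simp [mixedDerivation, pderiv_X]

theorem mixedDerivation_X_one : mixedDerivation (X 1) = X 0 * X 1 := by
  simp [mixedDerivation, pderiv_X]

theorem mixedDerivation_monomial (c : ℚ) (k l : ℕ) :
    mixedDerivation (C c * X 0 ^ k * X 1 ^ l) =
      C c * ((k : MvPolynomial (Fin 2) ℚ) * X 0 ^ k * X 1 ^ (l + 1) +
        (l : MvPolynomial (Fin 2) ℚ) * X 0 ^ (k + 1) * X 1 ^ l) := by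
  have hC : mixedDerivation (C c) = 0 := mixedDerivation.map_algebraMap c
  rw [Derivation.leibniz, Derivation.leibniz, Derivation.leibniz_pow, Derivation.leibniz_pow, hC,
    mixedDerivation_X_zero, mixedDerivation_X_one]
  simp only [smul_eq_mul, nsmul_eq_mul]
  obtain _ | k := k <;> obtain _ | l := l <;>
    simp [-mul_eq_mul_left_iff] <;> ring

theorem permutoH_succ (n : ℕ) :
    permutoH (n + 1) = (X 0 + X 1) * permutoH n + mixedDerivation (permutoH n) := by
  have hr : (X 0 + X 1) * permutoH n + mixedDerivation (permutoH n) =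
      ∑ k ∈ range (n + 1), C ((k + 1 : ℚ) * eulerian (n + 1) k) * X 0 ^ k * X 1 ^ (n + 1 - k) +
        ∑ k ∈ range (n + 1),
          C (((n + 1 - k : ℕ) : ℚ) * eulerian (n + 1) k) * X 0 ^ (k + 1) * X 1 ^ (n - k) := by
    rw [permutoH, map_sum, mul_sum, ← sum_add_distrib, ← sum_add_distrib]
    refine sum_congr rfl fun k hk => ?_
    have hk' : n + 1 - k = n - k + 1 := Nat.succ_sub (mem_range_succ_iff.mp hk)
    rw [mixedDerivation_monomial, hk']
    simp only [map_mul, map_add, map_natCast, map_one, Nat.cast_add, Nat.cast_one]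
    ring
  have hext : ∑ k ∈ range (n + 1),
      C ((k + 1 : ℚ) * eulerian (n + 1) k) * X 0 ^ k * X 1 ^ (n + 1 - k) =
      ∑ k ∈ range (n + 1 + 1),
        (C ((k + 1 : ℚ) * eulerian (n + 1) k) * X 0 ^ k * X 1 ^ (n + 1 - k) :
          MvPolynomial (Fin 2) ℚ) := by
    rw [sum_range_succ _ (n + 1), eulerian_self]
    simp
  rw [hr, hext, permutoH, sum_range_succ', sum_range_succ' _ (n + 1), add_right_comm (∑ k ∈ range (n + 1), _),
    ← sum_add_distrib]
  congr 1
  · refine sum_congr rfl fun k _ => ?_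
    rw [eulerian_succ_succ, Nat.add_sub_add_right]
    simp only [map_mul, map_add, map_natCast, map_one, Nat.cast_add, Nat.cast_one, Nat.cast_mul,
      Nat.cast_ofNat, map_ofNat]
    ring
  · rw [eulerian_succ_zero]
    simp

theorem permutoH_zero : permutoH 0 = 1 := by
  simp [permutoH, eulerian_succ_zero, eulerian_zero_zero]

theorem permutoH_eq_reflect (n : ℕ) :
    permutoH n =
      ∑ k ∈ range (n + 1), C (eulerian (n + 1) k : ℚ) * X 0 ^ (n - k) * X 1 ^ k := by
  rw [permutoH, ← sum_range_reflect]
  refine sum_congr rfl fun k hk => ?_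
  obtain ⟨l, rfl⟩ := Nat.exists_eq_add_of_le (mem_range_succ_iff.mp hk)
  rw [show k + l + 1 - 1 - k = l by omega, show k + l - k = l by omega,
    show k + l - l = k by omega, eulerian_symm]

/-- The homogeneous Eulerian polynomials `∑ k, A(n,k) α^k t^(n-1-k)`, with value `0` at `0`. -/
noncomputable def eulerianPoly : ℕ → MvPolynomial (Fin 2) ℚ
  | 0 => 0
  | n + 1 => permutoH n

theorem one_eq_egf {R : Type*} [CommRing R] [Algebra ℚ R] :
    (1 : PowerSeries R) = egf fun n => if n = 0 then 1 else 0 := by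
  ext n
  rw [coeff_egf, PowerSeries.coeff_one]
  by_cases h : n = 0 <;> simp [h]

theorem derivative_egf_eulerianPoly :
    PowerSeries.derivative _ (egf eulerianPoly) =
      1 + PowerSeries.C (X 0 + X 1) * egf eulerianPoly +
        PowerSeries.C (X 0 * X 1) * (egf eulerianPoly * egf eulerianPoly) := by
  refine riccati_of_derivative_eq mixedDerivation mixedDerivation_X_zero mixedDerivation_X_one
    ?_ ?_
  · rw [coeff_egf, eulerianPoly, smul_zero]
  · rw [derivative_egf, C_mul_egf, coeffwise_egf, one_eq_egf, egf_add, egf_add]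
    congr 1
    funext n
    obtain _ | n := n
    · simp [eulerianPoly, permutoH_zero]
    · simp [eulerianPoly, permutoH_succ]

theorem stelloH_eq_sum (n : ℕ) :
    stelloH n = X 0 ^ n +
      ∑ k ∈ range n, (n.choose (k + 1) : MvPolynomial (Fin 2) ℚ) *
        (X 1 * permutoH k * X 0 ^ (n - (k + 1))) := by
  have hIcc (i : ℕ) : Icc (1 + i) n = Ico (1 + i) (n + 1) := by ext; simp
  rw [stelloH, show Icc 1 n = Ico 1 (n + 1) from hIcc 0, sum_Ico_eq_sum_range,
    Nat.add_sub_cancel]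
  congr 1
  have hinner (i : ℕ) : ∑ k ∈ Icc (1 + i) n, n.choose k * eulerian k (1 + i - 1) =
      ∑ k ∈ Ico i n, n.choose (k + 1) * eulerian (k + 1) i := by
    rw [hIcc, add_comm 1 i, ← sum_Ico_add' (fun k => n.choose k * eulerian k (i + 1 - 1)),
      Nat.add_sub_cancel]
  simp only [hinner, Nat.cast_sum, map_sum, sum_mul]
  rw [range_eq_Ico, sum_Ico_Ico_comm]
  refine sum_congr rfl fun k hk => ?_
  obtain ⟨l, rfl⟩ := Nat.exists_eq_add_of_lt (mem_Ico.mp hk).2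
  rw [permutoH_eq_reflect, ← range_eq_Ico, mul_sum, sum_mul, mul_sum]
  refine sum_congr rfl fun i hi => ?_
  obtain ⟨j, rfl⟩ := Nat.exists_eq_add_of_le (mem_range_succ_iff.mp hi)
  rw [show i + j + l + 1 - (1 + i) = j + l by omega,
    show i + j + l + 1 - (i + j + 1) = l by omega, show i + j - i = j by omega]
  simp only [Nat.cast_mul, map_mul, map_natCast]
  ring

theorem egf_stelloH :
    egf stelloH =
      (1 + PowerSeries.C (X 1) * egf eulerianPoly) *
        egf fun n => (X 0 ^ n : MvPolynomial (Fin 2) ℚ) := by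
  rw [one_eq_egf, C_mul_egf, egf_add, egf_mul]
  congr 1
  funext n
  rw [Nat.sum_antidiagonal_eq_sum_range_succ_mk, sum_range_succ', stelloH_eq_sum, add_comm]
  simp [eulerianPoly]

theorem derivative_egf_stelloH :
    PowerSeries.derivative _ (egf stelloH) =
      PowerSeries.C (X 0 + X 1) * egf stelloH +
        PowerSeries.C (X 0 * X 1) * (egf stelloH * egf eulerianPoly) := by
  have hE : PowerSeries.derivative _ (egf fun n => (X 0 ^ n : MvPolynomial (Fin 2) ℚ)) =
      PowerSeries.C (X 0) * egf fun n => (X 0 ^ n : MvPolynomial (Fin 2) ℚ) := by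
    rw [derivative_egf, C_mul_egf]
    congr 1
    funext n
    exact pow_succ' _ _
  have hC : PowerSeries.derivative _ (PowerSeries.C (X 1 : MvPolynomial (Fin 2) ℚ)) = 0 :=
    PowerSeries.derivative_C
  rw [egf_stelloH, Derivation.leibniz, hE, map_add, Derivation.leibniz,
    PowerSeries.derivative_one, hC, derivative_egf_eulerianPoly]
  simp only [smul_eq_mul, map_add, map_mul]
  ring

theorem stelloH_succ (m : ℕ) :
    stelloH (m + 1) = (X 0 + X 1) * stelloH m +
      X 0 * X 1 * ∑ k ∈ range m, C (m.choose k : ℚ) * (stelloH k * permutoH (m - k - 1)) := by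
  have h := derivative_egf_stelloH
  rw [derivative_egf, egf_mul, C_mul_egf, C_mul_egf, egf_add] at h
  have hsum : ∑ p ∈ HasAntidiagonal.antidiagonal m,
      (m.choose p.1 : MvPolynomial (Fin 2) ℚ) * (stelloH p.1 * eulerianPoly p.2) =
      ∑ k ∈ range m, C (m.choose k : ℚ) * (stelloH k * permutoH (m - k - 1)) := by
    rw [Nat.sum_antidiagonal_eq_sum_range_succ_mk, sum_range_succ, Nat.sub_self, eulerianPoly,
      mul_zero, mul_zero, add_zero]
    refine sum_congr rfl fun k hk => ?_
    obtain ⟨l, rfl⟩ := Nat.exists_eq_add_of_lt (mem_range.mp hk)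
    rw [show k + l + 1 - k = l + 1 by omega, Nat.add_sub_cancel, eulerianPoly, map_natCast]
  rw [← hsum]
  exact congrFun (egf_injective h) m

theorem stelloH_recurrence (n : ℕ) (hn : 1 ≤ n) :
    stelloH n =
      (MvPolynomial.X 0 + MvPolynomial.X 1) * stelloH (n - 1) +
        MvPolynomial.X 0 * MvPolynomial.X 1 *
          ∑ i ∈ Finset.Icc 1 (n - 1),
            MvPolynomial.C (((n - 1).choose (i - 1) : ℚ)) *
              (stelloH (i - 1) * permutoH (n - i - 1)) := by
  obtain ⟨m, rfl⟩ := Nat.exists_eq_add_of_le' hn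
  rw [Nat.add_sub_cancel, stelloH_succ, show Icc 1 m = Ico 1 (m + 1) by ext; simp,
    sum_Ico_eq_sum_range, Nat.add_sub_cancel]
  simp only [Nat.add_sub_cancel_left, Nat.sub_sub, show ∀ k, m + 1 - (1 + k + 1) = m - (k + 1) by
    intro k; omega]
end

section
/- For all natural numbers n ≥ 1 and 0 ≤ i ≤ n: (1/(n+1))·binom(n+1,i)·binom(n+1,i+1) ≤ binom(n,i)², i.e. binom(n+1,i)·binom(n+1,i+1) ≤ (n+1)·binom(n,i)². -/
/-- `h_i(As^n) ≤ h_i(Cy^n)`: for `n ≥ 1` and `0 ≤ i ≤ n`,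
`(1/(n+1))·binom(n+1,i)·binom(n+1,i+1) ≤ binom(n,i)²`, i.e.
`binom(n+1,i)·binom(n+1,i+1) ≤ (n+1)·binom(n,i)²`. -/
theorem associahedron_le_cyclohedron_h (n i : ℕ) (hn : 1 ≤ n) (hi : i ≤ n) :
    (n + 1).choose i * (n + 1).choose (i + 1) ≤ (n + 1) * n.choose i ^ 2 := by
  obtain ⟨k, rfl⟩ := Nat.exists_eq_add_of_le hi
  have h₁ := Nat.choose_mul_succ_eq (i + k) i
  have h₂ := Nat.add_one_mul_choose_eq (i + k) i
  rw [show i + k + 1 - i = k + 1 by omega] at h₁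
  refine Nat.le_of_mul_le_mul_left ?_ (Nat.succ_pos (i + k))
  calc (i + k + 1) * ((i + k + 1).choose i * (i + k + 1).choose (i + 1))
      ≤ ((k + 1) * (i + 1)) * ((i + k + 1).choose i * (i + k + 1).choose (i + 1)) := by
        gcongr
        nlinarith [Nat.zero_le (i * k)]
    _ = ((i + k + 1).choose i * (k + 1)) * ((i + k + 1).choose (i + 1) * (i + 1)) := by ring
    _ = (i + k + 1) * ((i + k + 1) * (i + k).choose i ^ 2) := by
        rw [← h₁, ← h₂]
        ring
end
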